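/- Let x̄ ∈ ℝ and let Y : [0,∞) → ℝ be a càdlàg path with Y_0 ≤ x̄ such that its running supremum Ȳ_t = max(x̄, sup_{0≤s≤t} Y_s) is finite-valued and continuous in t. Let H : [0,∞) → ℝ be bounded measurable with H_s ≤ 1 for all s, define U_t = Y_t − ∫_{(0,t]} H_s dȲ_s, U_{s−} = Y_{s−} − ∫_{(0,s)} H_u dȲ_u, and Ū_t = max(x̄, sup_{0≤s≤t} U_s). Then the set {s > 0 : U_{s−} < Ū_s} is a null set for the Lebesgue–Stieltjes measure dȲ. -/

import Mathlib

open MeasureTheory Set Filter Function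

noncomputable section

/-- Running supremum of a path over `[0, t]`. -/
def runSSup (Z : ℝ → ℝ) (t : ℝ) : ℝ := sSup (Z '' Set.Icc 0 t)

/-- Running supremum of a path with initial maximum level `xbar`. -/
def runSup (xbar : ℝ) (Z : ℝ → ℝ) (t : ℝ) : ℝ := max xbar (runSSup Z t)

/-- Skorokhod regulator at 0. -/
def Psi (Y : ℝ → ℝ) (t : ℝ) : ℝ := max 0 (-(sInf (Y '' Set.Icc 0 t)))

/-- Reflection of a path at 0 from below. -/
def Phi (Y : ℝ → ℝ) (t : ℝ) : ℝ := Y t + Psi Y t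

/-- A path, viewed on `[0,∞)`, is càdlàg: right-continuous at every `t ≥ 0` and
with left limits at every `t > 0`. -/
def Cadlag (Z : ℝ → ℝ) : Prop :=
  (∀ t : ℝ, 0 ≤ t → ContinuousWithinAt Z (Set.Ici t) t) ∧
  (∀ t : ℝ, 0 < t → ∃ l : ℝ, Filter.Tendsto Z (nhdsWithin t (Set.Iio t)) (nhds l))

/-- A càdlàg path has no positive jumps if `ΔZ_t = Z_t - Z_{t-} ≤ 0` for all `t > 0`. -/
def NoPosJumps (Z : ℝ → ℝ) : Prop :=
  ∀ t : ℝ, 0 < t → Z t ≤ Function.leftLim Z t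

/-- Lebesgue–Stieltjes measure of an increasing right-continuous path on `[0,∞)`,
without the atom at `0`. -/
def lsMeasureAux (f : ℝ → ℝ) : Measure ℝ := by
  classical
  exact if h : Monotone (fun t => f (max t 0)) ∧
      ∀ x : ℝ, ContinuousWithinAt (fun t => f (max t 0)) (Set.Ici x) x then
    StieltjesFunction.measure ⟨fun t => f (max t 0), h.1, h.2⟩
  else 0

/-- Lebesgue–Stieltjes measure of an increasing right-continuous path on `[0,∞)`,
with an atom of mass `f 0` at `0`. -/
def lsMeasure (f : ℝ → ℝ) : Measure ℝ :=
  lsMeasureAux f + (ENNReal.ofReal (f 0)) • Measure.dirac 0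

/-- `(V, K)` is a tax-reflection pair for `(X, δ, xbar)`. -/
def IsTaxReflectionPair (δ : ℝ → ℝ) (X : ℝ → ℝ) (xbar : ℝ) (V K : ℝ → ℝ) : Prop :=
  Cadlag V ∧ Cadlag K ∧
  (∀ t : ℝ, 0 ≤ t → 0 ≤ V t) ∧
  MonotoneOn K (Set.Ici 0) ∧
  (∀ t : ℝ, 0 ≤ t →
    V t = X t + K t -
      ∫ s in Set.Ioc (0:ℝ) t, δ (V s)
        ∂(lsMeasure (runSup xbar (fun s => X s + K s)))) ∧
  lsMeasure K {t : ℝ | 0 ≤ t ∧ 0 < V t} = 0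

/-- A solution of the ODE `y' = 1 - δ(y)`, `y(0) = y₀`, on `[0,∞)`. -/
def IsFlow (δ : ℝ → ℝ) (y₀ : ℝ) (y : ℝ → ℝ) : Prop :=
  ContinuousOn y (Set.Ici 0) ∧
  ∀ t : ℝ, 0 ≤ t → y t = y₀ + ∫ s in (0:ℝ)..t, (1 - δ (y s))

/-- `δ` admits a unique flow: for every `y₀ ≥ 0` the ODE `y' = 1 - δ(y)`, `y(0) = y₀`
has exactly one continuous solution on `[0,∞)`. -/
def AdmitsUniqueFlow (δ : ℝ → ℝ) : Prop :=
  ∀ y₀ : ℝ, 0 ≤ y₀ →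
    (∃ y : ℝ → ℝ, IsFlow δ y₀ y) ∧
    ∀ y z : ℝ → ℝ, IsFlow δ y₀ y → IsFlow δ y₀ z → ∀ t : ℝ, 0 ≤ t → y t = z t

theorem runSup_le {xbar a t : ℝ} {Z : ℝ → ℝ} (ht : 0 ≤ t) (hx : xbar ≤ a)
    (hZ : ∀ s ∈ Icc 0 t, Z s ≤ a) : runSup xbar Z t ≤ a := by
  refine max_le hx (csSup_le ((nonempty_Icc.2 ht).image Z) ?_)
  rintro _ ⟨s, hs, rfl⟩
  exact hZ s hs

theorem le_runSup {xbar s t : ℝ} {Z : ℝ → ℝ} (hZ : BddAbove (Z '' Icc 0 t)) (hs : s ∈ Icc 0 t) :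
    Z s ≤ runSup xbar Z t :=
  (le_csSup hZ (mem_image_of_mem Z hs)).trans (le_max_right _ _)

theorem runSup_monotoneOn {xbar : ℝ} {Z : ℝ → ℝ}
    (hZ : ∀ t : ℝ, 0 ≤ t → BddAbove (Z '' Icc 0 t)) : MonotoneOn (runSup xbar Z) (Ici 0) :=
  fun _ hs t ht hst => runSup_le hs (le_max_left _ _) fun _ hu =>
    le_runSup (hZ t ht) ⟨hu.1, hu.2.trans hst⟩

theorem runSup_zero {xbar : ℝ} {Z : ℝ → ℝ} (h0 : Z 0 ≤ xbar) : runSup xbar Z 0 = xbar := by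
  simp [runSup, runSSup, h0]

/-- Immediately to the left of a time whose left limit lies strictly below a continuous running
supremum, the running supremum is constant. -/
theorem exists_lt_runSup_eq {xbar l s : ℝ} {Z : ℝ → ℝ}
    (hZ : ∀ t : ℝ, 0 ≤ t → BddAbove (Z '' Icc 0 t))
    (hcont : ContinuousOn (runSup xbar Z) (Ici 0)) (hs : 0 < s)
    (hl : Tendsto Z (nhdsWithin s (Iio s)) (nhds l)) (hlt : l < runSup xbar Z s) :
    ∃ a, 0 ≤ a ∧ a < s ∧ ∀ u ∈ Icc a s, runSup xbar Z u = runSup xbar Z s := by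
  obtain ⟨c, hlc, hcs⟩ := exists_between hlt
  have hsup : Tendsto (runSup xbar Z) (nhdsWithin s (Iio s)) (nhds (runSup xbar Z s)) :=
    (hcont.continuousAt (Ici_mem_nhds hs)).tendsto.mono_left nhdsWithin_le_nhds
  have hev : ∀ᶠ u in nhdsWithin s (Iio s), Z u < c ∧ c < runSup xbar Z u :=
    (hl.eventually_lt_const hlc).and (hsup.eventually_const_lt hcs)
  obtain ⟨b, hbs, hb⟩ := (mem_nhdsLT_iff_exists_Ioo_subset' hs).1 hev
  obtain ⟨a, hba, has⟩ := exists_between (max_lt hbs hs)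
  have ha : 0 ≤ a := (le_max_right _ _).trans hba.le
  have hb' : ∀ u, a ≤ u → u < s → Z u < c ∧ c < runSup xbar Z u := fun u hau hus =>
    hb ⟨((le_max_left _ _).trans_lt hba).trans_le hau, hus⟩
  have hmono := runSup_monotoneOn (xbar := xbar) hZ
  have hconst : ∀ u, a ≤ u → u < s → runSup xbar Z u = runSup xbar Z a := by
    intro u hau hus
    refine le_antisymm (runSup_le (ha.trans hau) (le_max_left _ _) fun v hv => ?_)
      (hmono ha (ha.trans hau) hau)
    rcases le_total v a with hva | hav
    · exact le_runSup (hZ a ha) ⟨hv.1, hva⟩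
    · exact ((hb' v hav (hv.2.trans_lt hus)).1.trans (hb' a le_rfl has).2).le
  have hsa : runSup xbar Z s = runSup xbar Z a := by
    refine tendsto_nhds_unique (hsup.congr' ?_) tendsto_const_nhds
    filter_upwards [Ioo_mem_nhdsLT has] with u hu using hconst u hu.1.le hu.2
  refine ⟨a, ha, has, fun u hu => ?_⟩
  rcases hu.2.eq_or_lt with rfl | hus
  · rfl
  · rw [hconst u hu.1 hus, hsa]

/-- A set is null for the measure of a continuous Stieltjes function which is constant
immediately to the left of each of its points. -/
theorem StieltjesFunction.measure_eq_zero_of_forall_exists_lt_eq (f : StieltjesFunction ℝ)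
    (hf : Continuous f) {B : Set ℝ} (hB : ∀ s ∈ B, ∃ a < s, ∀ u ∈ Icc a s, f u = f s) :
    f.measure B = 0 := by
  have hnull : ∀ p : ℚ × ℕ, f.measure {s ∈ Icc (p.1 : ℝ) p.2 | f s = f p.1} = 0 := by
    rintro ⟨q, n⟩
    rcases eq_empty_or_nonempty {s ∈ Icc (q : ℝ) n | f s = f q} with h | h
    · rw [h, measure_empty]
    have hcomp : IsCompact {s ∈ Icc (q : ℝ) n | f s = f q} :=
      isCompact_Icc.inter_right (isClosed_eq hf continuous_const)
    obtain ⟨m, hm, hmax⟩ := hcomp.exists_isGreatest h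
    refine measure_mono_null (t := Icc (q : ℝ) m) (fun s hs => ⟨hs.1.1, hmax hs⟩) ?_
    rw [f.measure_Icc, hf.continuousWithinAt.leftLim_eq, hm.2]
    simp
  refine measure_mono_null (fun s hs => ?_) (measure_iUnion_null hnull)
  obtain ⟨a, has, ha⟩ := hB s hs
  obtain ⟨q, haq, hqs⟩ := exists_rat_btwn has
  obtain ⟨n, hn⟩ := exists_nat_ge s
  exact mem_iUnion.2 ⟨(q, n), ⟨hqs.le, hn⟩, (ha q ⟨haq.le, hqs.le⟩).symm⟩

theorem StieltjesFunction.nullSingletonClass_measure (f : StieltjesFunction ℝ) (hf : Continuous f) :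
    NullSingletonClass f.measure :=
  ⟨fun a => by rw [f.measure_singleton, hf.continuousWithinAt.leftLim_eq]; simp⟩

/-- Up to the atom at `0`, the Lebesgue–Stieltjes measure of a path that is increasing and
continuous on `[0, ∞)` is the measure of a continuous Stieltjes function. -/
theorem exists_lsMeasure_eq {F : ℝ → ℝ} (hmono : MonotoneOn F (Ici 0))
    (hcont : ContinuousOn F (Ici 0)) :
    ∃ f : StieltjesFunction ℝ, Continuous f ∧ (∀ t, 0 ≤ t → f t = F t) ∧
      lsMeasure F = f.measure + ENNReal.ofReal (F 0) • Measure.dirac 0 := by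
  have hm : Monotone fun t => F (max t 0) := fun s t hst =>
    hmono (mem_Ici.2 (le_max_right s 0)) (mem_Ici.2 (le_max_right t 0)) (max_le_max_right 0 hst)
  have hc : Continuous fun t => F (max t 0) :=
    hcont.comp_continuous (by fun_prop) fun t => mem_Ici.2 (le_max_right t 0)
  refine ⟨⟨fun t => F (max t 0), hm, fun x => hc.continuousWithinAt⟩, hc,
    fun t ht => congrArg F (max_eq_left ht), ?_⟩
  rw [lsMeasure, lsMeasureAux, dif_pos ⟨hm, fun x => hc.continuousWithinAt⟩]

/-- The compensated supremum `t ↦ f t - ∫_{(0,t]} H df` is increasing when `H ≤ 1`. -/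
theorem StieltjesFunction.sub_setIntegral_le (f : StieltjesFunction ℝ) {H : ℝ → ℝ}
    (hHmeas : Measurable H) (hHbdd : ∃ C : ℝ, ∀ s : ℝ, |H s| ≤ C) (hH1 : ∀ s : ℝ, H s ≤ 1)
    {s t : ℝ} (hs : 0 ≤ s) (hst : s ≤ t) :
    f s - ∫ u in Ioc 0 s, H u ∂f.measure ≤ f t - ∫ u in Ioc 0 t, H u ∂f.measure := by
  obtain ⟨C, hC⟩ := hHbdd
  have hint : ∀ a b : ℝ, IntegrableOn H (Ioc a b) f.measure := fun a b =>
    Measure.integrableOn_of_bounded measure_Ioc_lt_top.ne hHmeas.aestronglyMeasurable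
      (Eventually.of_forall hC)
  have hsplit : ∫ u in Ioc 0 t, H u ∂f.measure
      = (∫ u in Ioc 0 s, H u ∂f.measure) + ∫ u in Ioc s t, H u ∂f.measure := by
    rw [← Ioc_union_Ioc_eq_Ioc hs hst]
    exact setIntegral_union (Ioc_disjoint_Ioc_of_le le_rfl) measurableSet_Ioc (hint _ _) (hint _ _)
  have hle : ∫ u in Ioc s t, H u ∂f.measure ≤ ∫ _ in Ioc s t, (1 : ℝ) ∂f.measure :=
    setIntegral_mono (hint s t) (integrableOn_const measure_Ioc_lt_top.ne) hH1
  have hone : ∫ _ in Ioc s t, (1 : ℝ) ∂f.measure = f t - f s := by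
    simp [Measure.real, ENNReal.toReal_ofReal, f.mono hst]
  linarith

/-- **The set where the left limit of the taxed process is strictly below its running
supremum is null for `dȲ`.** -/
theorem taxed_process_left_limit_null_set
    (xbar : ℝ) (Y : ℝ → ℝ) (hY : Cadlag Y) (hY0 : Y 0 ≤ xbar)
    (hYbdd : ∀ t : ℝ, 0 ≤ t → BddAbove (Y '' Set.Icc 0 t))
    (hcont : ContinuousOn (runSup xbar Y) (Set.Ici 0))
    (H : ℝ → ℝ) (hHmeas : Measurable H)
    (hHbdd : ∃ C : ℝ, ∀ s : ℝ, |H s| ≤ C)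
    (hH1 : ∀ s : ℝ, H s ≤ 1)
    (U Uminus : ℝ → ℝ)
    (hU : ∀ t : ℝ, U t = Y t - ∫ s in Set.Ioc (0:ℝ) t, H s ∂(lsMeasure (runSup xbar Y)))
    (hUminus : ∀ s : ℝ, 0 < s →
      Uminus s = Function.leftLim Y s -
        ∫ u in Set.Ioo (0:ℝ) s, H u ∂(lsMeasure (runSup xbar Y))) :
    lsMeasure (runSup xbar Y) {s : ℝ | 0 < s ∧ Uminus s < runSup xbar U s} = 0 := by
  obtain ⟨f, hf, hfF, hμ⟩ := exists_lsMeasure_eq (runSup_monotoneOn hYbdd) hcont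
  have := f.nullSingletonClass_measure hf
  have hrestrict : ∀ S : Set ℝ, MeasurableSet S → (0 : ℝ) ∉ S →
      (lsMeasure (runSup xbar Y)).restrict S = f.measure.restrict S := fun S hS h0 => by
    classical
    rw [hμ, Measure.restrict_add, Measure.restrict_smul, restrict_dirac' hS, if_neg h0,
      smul_zero, add_zero]
  have hUle : ∀ t, 0 ≤ t → runSup xbar U t ≤
      runSup xbar Y t - ∫ u in Ioc 0 t, H u ∂f.measure := by
    intro t ht
    have hA : ∀ s ∈ Icc 0 t, runSup xbar Y s - ∫ u in Ioc 0 s, H u ∂f.measure ≤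
        runSup xbar Y t - ∫ u in Ioc 0 t, H u ∂f.measure := fun s hs => by
      rw [← hfF s hs.1, ← hfF t ht]
      exact f.sub_setIntegral_le hHmeas hHbdd hH1 hs.1 hs.2
    refine runSup_le ht ?_ fun s hs => ?_
    · simpa [runSup_zero hY0] using hA 0 ⟨le_rfl, ht⟩
    · rw [hU, hrestrict _ measurableSet_Ioc (by simp)]
      exact (sub_le_sub_right (le_runSup (hYbdd s hs.1) ⟨hs.1, le_rfl⟩) _).trans (hA s hs)
  have hnull : f.measure {s : ℝ | 0 < s ∧ Uminus s < runSup xbar U s} = 0 := by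
    refine f.measure_eq_zero_of_forall_exists_lt_eq hf ?_
    rintro s ⟨hs, hlt⟩
    have hY' : leftLim Y s < runSup xbar Y s := by
      have h := hlt.trans_le (hUle s hs.le)
      rw [hUminus s hs, hrestrict _ measurableSet_Ioo (by simp),
        restrict_Ioo_eq_restrict_Ioc] at h
      exact (sub_lt_sub_iff_right _).1 h
    obtain ⟨a, ha, has, heq⟩ := exists_lt_runSup_eq hYbdd hcont hs
      (tendsto_leftLim_of_tendsto (hY.2 s hs)) hY'
    refine ⟨a, has, fun u hu => ?_⟩
    rw [hfF u (ha.trans hu.1), hfF s hs.le, heq u hu]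
  simp [hμ, hnull]

end
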